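/- arXiv:1003.3934 — 2 statements merged into one kernel-verified Lean document; each statement's English description precedes it below -/
import Mathlib

section
/- Let a, b, x, y, z be real numbers satisfying az = 0, ax + by = 0 and bx − ay = 0. Then the unique alternating bilinear map ⁅·,·⁆ : ℝ³ × ℝ³ → ℝ³ determined on the standard basis e₁, e₂, e₃ by ⁅e₁,e₂⁆ = x e₁ + y e₂ + z e₃, ⁅e₃,e₁⁆ = a e₁ + b e₂ and ⁅e₃,e₂⁆ = −b e₁ + a e₂ satisfies the Jacobi identity, i.e. it makes ℝ³ into a real Lie algebra. -/
/-- An alternating bilinear map on `Fin 3 → R` is determined by its values on the pairs of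
standard basis vectors `(e₀, e₁)`, `(e₂, e₀)`, `(e₂, e₁)`. -/
theorem LinearMap.apply_eq_of_alternating_fin_three {R M : Type*} [CommRing R] [AddCommGroup M]
    [Module R M] (B : (Fin 3 → R) →ₗ[R] (Fin 3 → R) →ₗ[R] M) (halt : ∀ v, B v v = 0)
    (u v : Fin 3 → R) :
    B u v = (u 0 * v 1 - u 1 * v 0) • B (Pi.single 0 1) (Pi.single 1 1)
      + (u 2 * v 0 - u 0 * v 2) • B (Pi.single 2 1) (Pi.single 0 1)
      + (u 2 * v 1 - u 1 * v 2) • B (Pi.single 2 1) (Pi.single 1 1) := by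
  have hneg (p q : Fin 3 → R) : B p q = -B q p := ((show B.IsAlt from halt).neg q p).symm
  have hsum (w : Fin 3 → R) :
      w = w 0 • Pi.single 0 1 + w 1 • Pi.single 1 1 + w 2 • Pi.single 2 1 := by
    ext i
    fin_cases i <;> simp
  conv_lhs => rw [hsum u, hsum v]
  simp only [map_add, map_smul, LinearMap.add_apply, LinearMap.smul_apply, halt,
    hneg (Pi.single 1 1) (Pi.single 0 1), hneg (Pi.single 0 1) (Pi.single 2 1),
    hneg (Pi.single 1 1) (Pi.single 2 1)]
  module

/-- If `az = 0`, `ax + by = 0`, `bx - ay = 0`, then the alternating bilinear map on `ℝ³`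
determined on the standard basis by `⁅e₁,e₂⁆ = xe₁ + ye₂ + ze₃`, `⁅e₃,e₁⁆ = ae₁ + be₂`,
`⁅e₃,e₂⁆ = -be₁ + ae₂` satisfies the Jacobi identity. -/
theorem jacobi_identity_of_constraints
    (a b x y z : ℝ)
    (h1 : a * z = 0) (h2 : a * x + b * y = 0) (h3 : b * x - a * y = 0)
    (B : (Fin 3 → ℝ) →ₗ[ℝ] (Fin 3 → ℝ) →ₗ[ℝ] (Fin 3 → ℝ))
    (halt : ∀ v, B v v = 0)
    (h12 : B (Pi.single 0 1) (Pi.single 1 1) =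
      x • (Pi.single 0 1 : Fin 3 → ℝ) + y • (Pi.single 1 1 : Fin 3 → ℝ)
        + z • (Pi.single 2 1 : Fin 3 → ℝ))
    (h31 : B (Pi.single 2 1) (Pi.single 0 1) =
      a • (Pi.single 0 1 : Fin 3 → ℝ) + b • (Pi.single 1 1 : Fin 3 → ℝ))
    (h32 : B (Pi.single 2 1) (Pi.single 1 1) =
      (-b) • (Pi.single 0 1 : Fin 3 → ℝ) + a • (Pi.single 1 1 : Fin 3 → ℝ)) :
    ∀ u v w : Fin 3 → ℝ, B u (B v w) + B v (B w u) + B w (B u v) = 0 := by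
  intro u v w
  have hB (p q : Fin 3 → ℝ) : B p q =
      ![(p 0 * q 1 - p 1 * q 0) * x + (p 2 * q 0 - p 0 * q 2) * a
          - (p 2 * q 1 - p 1 * q 2) * b,
        (p 0 * q 1 - p 1 * q 0) * y + (p 2 * q 0 - p 0 * q 2) * b
          + (p 2 * q 1 - p 1 * q 2) * a,
        (p 0 * q 1 - p 1 * q 0) * z] := by
    rw [B.apply_eq_of_alternating_fin_three halt, h12, h31, h32]
    ext i
    fin_cases i <;> simp
    ring
  let d := u 0 * (v 1 * w 2 - v 2 * w 1) - u 1 * (v 0 * w 2 - v 2 * w 0)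
    + u 2 * (v 0 * w 1 - v 1 * w 0)
  ext i
  fin_cases i <;> simp [hB]
  · linear_combination (-d) * h2
  · linear_combination d * h3
  · linear_combination (-2 * d) * h1
end

section
/- Let L be a Lie algebra over ℝ and X, Y, Z ∈ L linearly independent vectors such that for some real numbers a, b, x, y, z one has ⁅X,Y⁆ = xX + yY + zZ, ⁅Z,X⁆ = aX + bY and ⁅Z,Y⁆ = −bX + aY. Then exactly one of the following holds after restricting the constants: (i) a = b = 0 and ⁅Z,X⁆ = ⁅Z,Y⁆ = 0; or (ii) x = y = z = 0 and ⁅X,Y⁆ = 0; or (iii) x = y = a = 0, so that ⁅X,Y⁆ = zZ, ⁅Z,X⁆ = bY and ⁅Z,Y⁆ = −bX. (Here 'exactly one' is meant in the inclusive sense that at least one of the three alternatives (i), (ii), (iii) holds.) -/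
/-- The Jacobi identity for `Z, X, Y`, expressed as a linear relation among them. -/
theorem admissible_bracket_jacobi
    {L : Type*} [LieRing L] [LieAlgebra ℝ L] {X Y Z : L} {a b x y z : ℝ}
    (hXY : ⁅X, Y⁆ = x • X + y • Y + z • Z)
    (hZX : ⁅Z, X⁆ = a • X + b • Y)
    (hZY : ⁅Z, Y⁆ = (-b) • X + a • Y) :
    (a * x + b * y) • X + (a * y - b * x) • Y + (2 * a * z) • Z = 0 := by
  have jacobi := leibniz_lie Z X Y
  simp only [hZX, hZY, hXY, lie_add, add_lie, lie_smul, smul_lie, lie_self] at jacobi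
  linear_combination (norm := module) -jacobi

/-- If `X, Y, Z` are linearly independent elements of a real Lie algebra with
`⁅X,Y⁆ = xX + yY + zZ`, `⁅Z,X⁆ = aX + bY`, `⁅Z,Y⁆ = -bX + aY`, then at least one
of the three alternatives holds: (i) `a = b = 0` (so `⁅Z,X⁆ = ⁅Z,Y⁆ = 0`);
(ii) `x = y = z = 0` (so `⁅X,Y⁆ = 0`); (iii) `x = y = a = 0` (so `⁅X,Y⁆ = zZ`,
`⁅Z,X⁆ = bY`, `⁅Z,Y⁆ = -bX`). -/
theorem admissible_bracket_trichotomy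
    {L : Type*} [LieRing L] [LieAlgebra ℝ L]
    (X Y Z : L) (hind : LinearIndependent ℝ ![X, Y, Z])
    (a b x y z : ℝ)
    (hXY : ⁅X, Y⁆ = x • X + y • Y + z • Z)
    (hZX : ⁅Z, X⁆ = a • X + b • Y)
    (hZY : ⁅Z, Y⁆ = (-b) • X + a • Y) :
    (a = 0 ∧ b = 0 ∧ ⁅Z, X⁆ = 0 ∧ ⁅Z, Y⁆ = 0) ∨
    (x = 0 ∧ y = 0 ∧ z = 0 ∧ ⁅X, Y⁆ = 0) ∨
    (x = 0 ∧ y = 0 ∧ a = 0 ∧ ⁅X, Y⁆ = z • Z ∧ ⁅Z, X⁆ = b • Y ∧ ⁅Z, Y⁆ = (-b) • X) := by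
  have hcoeff := Fintype.linearIndependent_iff.mp hind
    ![a * x + b * y, a * y - b * x, 2 * a * z]
    (by simpa [Fin.sum_univ_three] using admissible_bracket_jacobi hXY hZX hZY)
  have hX : a * x + b * y = 0 := hcoeff 0
  have hY : a * y - b * x = 0 := hcoeff 1
  have hZ : 2 * a * z = 0 := hcoeff 2
  by_cases hab : a = 0 ∧ b = 0
  · obtain ⟨rfl, rfl⟩ := hab
    exact Or.inl ⟨rfl, rfl, by simpa using hZX, by simpa using hZY⟩
  have hne : a ^ 2 + b ^ 2 ≠ 0 := fun h => hab ⟨by nlinarith, by nlinarith⟩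
  obtain rfl : x = 0 := (mul_eq_zero_iff_left hne).mp (by linear_combination a * hX - b * hY)
  obtain rfl : y = 0 := (mul_eq_zero_iff_left hne).mp (by linear_combination b * hX + a * hY)
  by_cases ha : a = 0
  · subst ha
    exact Or.inr (Or.inr ⟨rfl, rfl, rfl, by simpa using hXY, by simpa using hZX,
      by simpa using hZY⟩)
  · obtain rfl : z = 0 := by simpa [ha] using hZ
    exact Or.inr (Or.inl ⟨rfl, rfl, rfl, by simpa using hXY⟩)
end
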